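/- Let G be a finite graph in which every vertex has degree exactly 12, let C'' ⊆ C' be subgroups of the (abelian) vertex group with |C'|/|C''| = 4 and the total group of size 256, |C''| = 16, such that distinct elements of any coset of C'' are at graph distance at least 3 and distinct elements of any coset of C' are at distance at least 2, where the graph is a Cayley graph on the group. Then for any two cosets C₁'', C₂'' of C'' not contained in a common coset of C', and any x ∈ C₁'', there exists y ∈ C₂'' adjacent to x. -/

import Mathlib

theorem stmt_13 {A : Type*} [AddCommGroup A] [Fintype A]
    (hA : Fintype.card A = 256)
    (S : Finset A) (hScard : S.card = 12) (hS0 : (0 : A) ∉ S)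
    (hSsymm : ∀ s ∈ S, -s ∈ S)
    (G : SimpleGraph A) (hG : ∀ x y : A, G.Adj x y ↔ x - y ∈ S)
    (C'' C' : AddSubgroup A) (hle : C'' ≤ C')
    (h16 : Nat.card C'' = 16) (h64 : Nat.card C' = 64)
    (hd3 : ∀ a b : A, a - b ∈ C'' → a ≠ b → 3 ≤ G.dist a b)
    (hd2 : ∀ a b : A, a - b ∈ C' → a ≠ b → 2 ≤ G.dist a b) :
    ∀ x z : A, x - z ∉ C' → ∃ y : A, y - z ∈ C'' ∧ G.Adj x y := by
  classical
  have hSC : ∀ s ∈ S, s ∉ C' := by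
    intro s hs hc
    have h := hd2 s 0 (by simpa using hc) (by rintro rfl; exact hS0 hs)
    have hadj : G.Adj s 0 := (hG s 0).2 (by simpa using hs)
    have h1 : G.dist s 0 = 1 := SimpleGraph.dist_eq_one_iff_adj.2 hadj
    omega
  have hinj : ∀ s ∈ S, ∀ t ∈ S, s - t ∈ C'' → s = t := by
    intro s hs t ht hc
    by_contra hne
    have h := hd3 s t hc hne
    have h1 : G.Adj s 0 := (hG s 0).2 (by simpa using hs)
    have h2 : G.Adj 0 t := (hG 0 t).2 (by simpa using hSsymm t ht)
    have h3 := SimpleGraph.dist_le (SimpleGraph.Walk.cons h1 (SimpleGraph.Walk.cons h2 SimpleGraph.Walk.nil))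
    simp at h3
    omega
  let F : Finset A := Finset.univ.filter (fun a => a ∈ C'')
  let E : Finset A := Finset.univ.filter (fun a => a ∈ C')
  have hF : F.card = 16 := by
    rw [← h16, Nat.card_eq_fintype_card]
    exact (Fintype.card_subtype _).symm
  have hE : E.card = 64 := by
    rw [← h64, Nat.card_eq_fintype_card]
    exact (Fintype.card_subtype _).symm
  have hEc : Eᶜ.card = 192 := by
    rw [Finset.card_compl, hE, hA]
  have himg : ((S ×ˢ F).image (fun p : A × A => p.1 + p.2)).card = 192 := by
    rw [Finset.card_image_of_injOn, Finset.card_product, hF, hScard]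
    rintro ⟨s, c⟩ h1 ⟨t, d⟩ h2 h
    simp only [Finset.coe_product, Set.mem_prod, Finset.mem_coe, F, Finset.mem_filter,
      Finset.mem_univ, true_and] at h1 h2
    have h' : s + c = t + d := h
    have hst : s = t := by
      apply hinj s h1.1 t h2.1
      have : s - t = d - c := by rw [sub_eq_sub_iff_add_eq_add, h', add_comm]
      rw [this]
      exact C''.sub_mem h2.2 h1.2
    subst hst
    simpa using h'
  have hsub : (S ×ˢ F).image (fun p : A × A => p.1 + p.2) ⊆ Eᶜ := by
    intro a ha
    obtain ⟨⟨s, c⟩, h1, rfl⟩ := Finset.mem_image.1 ha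
    simp only [Finset.mem_product, F, Finset.mem_filter, Finset.mem_univ, true_and] at h1
    simp only [E, Finset.mem_compl, Finset.mem_filter, Finset.mem_univ, true_and]
    intro h
    exact hSC s h1.1 ((C'.add_mem_cancel_right (hle h1.2)).1 h)
  have heq := Finset.eq_of_subset_of_card_le hsub (by rw [hEc, himg])
  intro x z hxz
  have hm : x - z ∈ Eᶜ := by simpa [E] using hxz
  rw [← heq] at hm
  obtain ⟨⟨s, c⟩, h1, h2⟩ := Finset.mem_image.1 hm
  simp only [Finset.mem_product, F, Finset.mem_filter, Finset.mem_univ, true_and] at h1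
  refine ⟨x - s, ?_, (hG _ _).2 (by simpa using h1.1)⟩
  have h3 : s + c = x - z := h2
  have : x - s - z = c := by
    rw [sub_right_comm, ← h3]; abel
  rw [this]
  exact h1.2
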